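/- Second limit of the appendix example (inefficiency of the temporal jump estimator with respect to the error of the piecewise constant reconstruction as λ → ∞): with e_jump(λ) := (λ ∫₀¹ ((1−t)/(1+λ))² dt)^{1/2} and e_const(λ) := (½((1−e^{−λ})/λ − 1/(1+λ))² + λ ∫₀¹ ((1−e^{−λt})/λ − 1/(1+λ))² dt)^{1/2}, one has e_const(λ) > 0 for every λ > 0, and the ratio e_jump(λ)/e_const(λ) tends to +∞ as λ → ∞. -/

import Mathlib

open Filter

/-- The error of the constant reconstruction at the final time is positive. -/
lemma final_error_pos {l : ℝ} (hl : 0 < l) :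
    0 < (1 - Real.exp (-l)) / l - 1 / (1 + l) := by
  have h := Real.add_one_lt_exp hl.ne'
  have h2 : Real.exp (-l) < 1 / (1 + l) := by
    rw [Real.exp_neg, ← one_div]
    exact one_div_lt_one_div_of_lt (by linarith) (by linarith)
  have h3 : (1 - Real.exp (-l)) / l - 1 / (1 + l) = (1 / (1 + l) - Real.exp (-l)) / l := by
    field_simp
    ring
  rw [h3]
  exact div_pos (by linarith) hl

lemma error_sq_le {l : ℝ} (hl : 0 < l) (s : ℝ) :
    ((1 - Real.exp (-l * s)) / l - 1 / (1 + l)) ^ 2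
      ≤ 1 / l ^ 4 + Real.exp (-(2 * l) * s) / l ^ 2 := by
  have he : Real.exp (-(2 * l) * s) = Real.exp (-l * s) ^ 2 := by
    rw [← Real.exp_nat_mul]
    congr 1
    push_cast
    ring
  have hb : (1 - Real.exp (-l * s)) / l - 1 / (1 + l)
      = 1 / (l * (1 + l)) - Real.exp (-l * s) / l := by
    field_simp
    ring
  have hb0 : 0 < 1 / (l * (1 + l)) := by positivity
  have hc0 : 0 < Real.exp (-l * s) / l := by positivity
  have hble : 1 / (l * (1 + l)) ≤ 1 / l ^ 2 :=
    one_div_le_one_div_of_le (by positivity) (by nlinarith)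
  have hsq : (1 / (l * (1 + l))) ^ 2 ≤ 1 / l ^ 4 := by
    calc (1 / (l * (1 + l))) ^ 2 ≤ (1 / l ^ 2) ^ 2 := by gcongr
      _ = 1 / l ^ 4 := by field_simp
  rw [hb, he, ← div_pow]
  nlinarith [mul_pos hb0 hc0]

lemma integral_exp_neg_mul_le {c : ℝ} (hc : 0 < c) :
    ∫ s in (0:ℝ)..1, Real.exp (-c * s) ≤ 1 / c := by
  rw [intervalIntegral.integral_comp_mul_left (fun x => Real.exp x) (neg_ne_zero.mpr hc.ne'),
    integral_exp, smul_eq_mul, mul_one, mul_zero, Real.exp_zero, inv_neg, one_div]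
  have := Real.exp_pos (-c)
  have := inv_pos.mpr hc
  nlinarith

lemma integral_error_sq_le {l : ℝ} (hl : 0 < l) :
    ∫ s in (0:ℝ)..1, ((1 - Real.exp (-l * s)) / l - 1 / (1 + l)) ^ 2
      ≤ 1 / l ^ 4 + 1 / (2 * l) / l ^ 2 := by
  have hi : IntervalIntegrable (fun s : ℝ => Real.exp (-(2 * l) * s) / l ^ 2)
      MeasureTheory.volume 0 1 :=
    Continuous.intervalIntegrable (by fun_prop) _ _
  calc ∫ s in (0:ℝ)..1, ((1 - Real.exp (-l * s)) / l - 1 / (1 + l)) ^ 2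
      ≤ ∫ s in (0:ℝ)..1, (1 / l ^ 4 + Real.exp (-(2 * l) * s) / l ^ 2) :=
        intervalIntegral.integral_mono_on zero_le_one
          (Continuous.intervalIntegrable (by fun_prop) _ _)
          (Continuous.intervalIntegrable (by fun_prop) _ _)
          fun s _ => error_sq_le hl s
    _ = 1 / l ^ 4 + (∫ s in (0:ℝ)..1, Real.exp (-(2 * l) * s)) / l ^ 2 := by
        rw [intervalIntegral.integral_add (by simp) hi, intervalIntegral.integral_div]
        simp
    _ ≤ _ := by
        gcongr
        exact integral_exp_neg_mul_le (by positivity)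

lemma energy_error_sq_le {l : ℝ} (hl : 1 ≤ l) :
    (1/2) * ((1 - Real.exp (-l)) / l - 1 / (1 + l)) ^ 2
        + l * ∫ s in (0:ℝ)..1, ((1 - Real.exp (-l * s)) / l - 1 / (1 + l)) ^ 2
      ≤ 3 / l ^ 2 := by
  have hl0 : 0 < l := by linarith
  have h1 := error_sq_le hl0 1
  rw [mul_one, mul_one] at h1
  have h2 := mul_le_mul_of_nonneg_left (integral_error_sq_le hl0) hl0.le
  have he : Real.exp (-(2 * l)) / l ^ 2 ≤ 1 / l ^ 2 := by
    gcongr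
    exact Real.exp_le_one_iff.mpr (by linarith)
  have h4 : 1 / l ^ 4 ≤ 1 / l ^ 2 :=
    one_div_le_one_div_of_le (by positivity) (pow_le_pow_right₀ hl (by norm_num))
  have h3 : 1 / l ^ 3 ≤ 1 / l ^ 2 :=
    one_div_le_one_div_of_le (by positivity) (pow_le_pow_right₀ hl (by norm_num))
  have h5 : l * (1 / l ^ 4 + 1 / (2 * l) / l ^ 2) = 1 / l ^ 3 + 1 / l ^ 2 / 2 := by
    field_simp
  have h6 : 3 / l ^ 2 = 3 * (1 / l ^ 2) := by ring
  have h7 : 0 < 1 / l ^ 2 := by positivity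
  rw [h6]
  linarith

lemma jump_estimator_sq_ge {l : ℝ} (hl : 1 ≤ l) :
    1 / (12 * l) ≤ l * ∫ s in (0:ℝ)..1, ((1 - s) / (1 + l)) ^ 2 := by
  have hl0 : 0 < l := by linarith
  have hint : ∫ s in (0:ℝ)..1, ((1 - s) / (1 + l)) ^ 2 = 1 / 3 / (1 + l) ^ 2 := by
    simp_rw [div_pow]
    rw [intervalIntegral.integral_div,
      intervalIntegral.integral_comp_sub_left (fun x : ℝ => x ^ 2), integral_pow]
    norm_num
  rw [hint, div_div, mul_one_div, div_le_div_iff₀ (by positivity) (by positivity)]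
  nlinarith

/-- Second limit of the appendix example: the temporal jump estimator is not efficient
with respect to the energy-norm error of the piecewise constant reconstruction as
`λ → ∞`. -/
theorem stmt_13 :
    (∀ l : ℝ, 0 < l →
      0 < Real.sqrt ((1/2) * ((1 - Real.exp (-l)) / l - 1 / (1 + l)) ^ 2
          + l * ∫ s in (0:ℝ)..1, ((1 - Real.exp (-l * s)) / l - 1 / (1 + l)) ^ 2))
    ∧ Tendsto
        (fun l : ℝ =>
          Real.sqrt (l * ∫ s in (0:ℝ)..1, ((1 - s) / (1 + l)) ^ 2)
            / Real.sqrt ((1/2) * ((1 - Real.exp (-l)) / l - 1 / (1 + l)) ^ 2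
                + l * ∫ s in (0:ℝ)..1, ((1 - Real.exp (-l * s)) / l - 1 / (1 + l)) ^ 2))
        atTop atTop := by
  refine ⟨fun l hl => ?_, ?_⟩
  · have h := final_error_pos hl
    have hi : 0 ≤ ∫ s in (0:ℝ)..1, ((1 - Real.exp (-l * s)) / l - 1 / (1 + l)) ^ 2 :=
      intervalIntegral.integral_nonneg zero_le_one fun s _ => sq_nonneg _
    exact Real.sqrt_pos.mpr (by positivity)
  · have hlim : Tendsto (fun l : ℝ => Real.sqrt (l / 36)) atTop atTop :=
      Real.tendsto_sqrt_atTop.comp (tendsto_id.atTop_div_const (by norm_num))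
    refine tendsto_atTop_mono' atTop ?_ hlim
    filter_upwards [eventually_ge_atTop 1] with l hl
    have hl0 : 0 < l := by linarith
    have h := final_error_pos hl0
    have hi : 0 ≤ ∫ s in (0:ℝ)..1, ((1 - Real.exp (-l * s)) / l - 1 / (1 + l)) ^ 2 :=
      intervalIntegral.integral_nonneg zero_le_one fun s _ => sq_nonneg _
    have hN := jump_estimator_sq_ge hl
    rw [← Real.sqrt_div (le_trans (by positivity) hN)]
    apply Real.sqrt_le_sqrt
    calc l / 36 = 1 / (12 * l) / (3 / l ^ 2) := by
          field_simp
          norm_num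
      _ ≤ _ := div_le_div₀ (le_trans (by positivity) hN) hN (by positivity)
          (energy_error_sq_le hl)
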